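/- Let p be an odd prime, α, β, γ, δ : ℕ, and let 𝒞 be an additive subgroup of (Fin α → ZMod p) × (Fin β → ZMod (p²)) admitting an additive group isomorphism 𝒞 ≃+ (Fin γ → ZMod p) × (Fin δ → ZMod (p²)). Let C = Φ '' 𝒞 and suppose Nat.card (K(C)) = p^(γ + 2δ − k̄) for some k̄ with 1 ≤ k̄ ≤ δ. Then there exist elements v₁, …, v_k̄ ∈ 𝒞, each of additive order p² and with Φ(vᵢ) ∉ K(C), such that C = ⋃_{a ∈ Fin k̄ → ZMod p} (K(C) + Φ(∑ᵢ (aᵢ.val) • vᵢ)), and these p^k̄ cosets of K(C) are pairwise disjoint. -/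

import Mathlib

/-- The Gray map `φ : ZMod (p²) → (Fin p → ZMod p)`. -/
def gray (p : ℕ) (θ : ZMod (p ^ 2)) : Fin p → ZMod p :=
  fun i => ((θ.val / p : ℕ) : ZMod p) + ((θ.val % p : ℕ) : ZMod p) * ((i : ℕ) : ZMod p)

/-- The extended Gray map `Φ`. -/
def Gray (p α β : ℕ) (u : (Fin α → ZMod p) × (Fin β → ZMod (p ^ 2))) :
    (Fin α → ZMod p) × (Fin β → Fin p → ZMod p) :=
  (u.1, fun j => gray p (u.2 j))

/-- The kernel `K(C) = {x : x + C = C}` of a subset `C`. -/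
def kernelSet {V : Type*} [AddCommGroup V] (C : Set V) : Set V :=
  {x | (fun c => x + c) '' C = C}

/-- The coset `K + y = {x + y : x ∈ K}`. -/
def cosetOf {V : Type*} [AddCommGroup V] (K : Set V) (y : V) : Set V :=
  (fun x => x + y) '' K

theorem gray_natCast (p : ℕ) (_ : p.Prime) (n : ℕ) (i : Fin p) :
    gray p (n : ZMod (p ^ 2)) i = ((n / p : ℕ) : ZMod p) + (n : ZMod p) * ((i : ℕ) : ZMod p) := by
  unfold gray
  rw [ZMod.val_natCast, pow_two, Nat.mod_mul_right_div_self, Nat.mod_mul_right_mod]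
  simp

theorem gray_tors (p : ℕ) (hp : p.Prime) (t : ZMod (p ^ 2)) (ht : p • t = 0) :
    ∃ m : ℕ, t = ((p * m : ℕ) : ZMod (p ^ 2)) := by
  have : NeZero (p ^ 2) := ⟨pow_ne_zero _ hp.ne_zero⟩
  obtain ⟨n, rfl⟩ := ZMod.natCast_zmod_surjective t
  rw [nsmul_eq_mul, ← Nat.cast_mul, ZMod.natCast_eq_zero_iff, pow_two] at ht
  obtain ⟨m, rfl⟩ := Nat.dvd_of_mul_dvd_mul_left hp.pos ht
  exact ⟨m, rfl⟩

theorem gray_add_tors (p : ℕ) (hp : p.Prime) (x t : ZMod (p ^ 2)) (ht : p • t = 0) :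
    gray p (x + t) = gray p x + gray p t := by
  have : NeZero (p ^ 2) := ⟨pow_ne_zero _ hp.ne_zero⟩
  obtain ⟨m, rfl⟩ := gray_tors p hp t ht
  obtain ⟨n, rfl⟩ := ZMod.natCast_zmod_surjective x
  funext i
  rw [Pi.add_apply, ← Nat.cast_add, gray_natCast p hp, gray_natCast p hp, gray_natCast p hp,
    Nat.add_mul_div_left _ _ hp.pos, Nat.mul_div_cancel_left _ hp.pos]
  push_cast
  simp
  ring

theorem gray_add (p : ℕ) (hp : p.Prime) (x y : ZMod (p ^ 2)) :
    ∃ t : ZMod (p ^ 2), p • t = 0 ∧ gray p (x + y) = gray p x + gray p y + gray p t := by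
  have : NeZero (p ^ 2) := ⟨pow_ne_zero _ hp.ne_zero⟩
  obtain ⟨m, rfl⟩ := ZMod.natCast_zmod_surjective y
  obtain ⟨n, rfl⟩ := ZMod.natCast_zmod_surjective x
  refine ⟨((p * (if p ≤ n % p + m % p then 1 else 0) : ℕ) : ZMod (p ^ 2)), ?_, ?_⟩
  · rw [nsmul_eq_mul, ← Nat.cast_mul, ZMod.natCast_eq_zero_iff, pow_two, ← mul_assoc]
    exact dvd_mul_right _ _
  · funext i
    rw [Pi.add_apply, Pi.add_apply, ← Nat.cast_add, gray_natCast p hp, gray_natCast p hp,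
      gray_natCast p hp, gray_natCast p hp,
      Nat.add_div hp.pos, Nat.mul_div_cancel_left _ hp.pos]
    push_cast
    simp
    ring

theorem gray_injective (p : ℕ) (hp : p.Prime) : Function.Injective (gray p) := by
  have : NeZero (p ^ 2) := ⟨pow_ne_zero _ hp.ne_zero⟩
  intro x y h
  have h0 := congrFun h ⟨0, hp.pos⟩
  have h1 := congrFun h ⟨1, hp.one_lt⟩
  simp only [gray, Nat.cast_zero, mul_zero, add_zero, Nat.cast_one, mul_one] at h0 h1
  rw [h0] at h1
  have h2 := add_left_cancel h1
  have bd : ∀ z : ZMod (p ^ 2), z.val / p < p := fun z => by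
    rw [Nat.div_lt_iff_lt_mul hp.pos, ← pow_two]; exact ZMod.val_lt z
  rw [ZMod.natCast_eq_natCast_iff'] at h0 h2
  rw [Nat.mod_eq_of_lt (bd x), Nat.mod_eq_of_lt (bd y)] at h0
  rw [Nat.mod_mod, Nat.mod_mod] at h2
  apply ZMod.val_injective
  rw [← Nat.div_add_mod x.val p, ← Nat.div_add_mod y.val p, h0, h2]

section abs
variable {G V : Type*} [AddCommGroup G] [AddCommGroup V]

theorem mem_kernelSet {C : Set V} {x : V} :
    x ∈ kernelSet C ↔ (∀ c ∈ C, x + c ∈ C) ∧ (∀ c ∈ C, -x + c ∈ C) := by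
  unfold kernelSet
  constructor
  · intro (h : _ = _)
    refine ⟨fun c hc => h ▸ ⟨c, hc, rfl⟩, fun c hc => ?_⟩
    rw [← h] at hc
    obtain ⟨d, hd, rfl⟩ := hc
    simpa using hd
  · rintro ⟨h1, h2⟩
    ext c
    constructor
    · rintro ⟨d, hd, rfl⟩; exact h1 d hd
    · intro hc; exact ⟨-x + c, h2 c hc, by simp⟩

theorem kernelSet_add {C : Set V} {x y : V} (hx : x ∈ kernelSet C) (hy : y ∈ kernelSet C) :
    x + y ∈ kernelSet C := by
  rw [mem_kernelSet] at *
  refine ⟨fun c hc => ?_, fun c hc => ?_⟩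
  · rw [add_assoc]; exact hx.1 _ (hy.1 _ hc)
  · rw [neg_add, add_assoc]; exact hx.2 _ (hy.2 _ hc)

theorem kernelSet_neg {C : Set V} {x : V} (hx : x ∈ kernelSet C) : -x ∈ kernelSet C := by
  rw [mem_kernelSet] at *
  rw [neg_neg]
  exact hx.symm

theorem exists_zmod_basis_aux {Q : Type*} [AddCommGroup Q] (p : ℕ) [Fact p.Prime]
    [Module (ZMod p) Q] (k : ℕ) (hcardQ : Nat.card Q = p ^ k) :
    ∃ B : Fin k → Q, (∀ i, B i ≠ 0) ∧
      Function.Bijective (fun a : Fin k → ZMod p => ∑ i, (a i).val • B i) := by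
  have hp : p.Prime := Fact.out
  have : Finite Q := Nat.finite_of_card_ne_zero (by rw [hcardQ]; exact pow_ne_zero _ hp.ne_zero)
  have : Module.Finite (ZMod p) Q := Module.Finite.of_finite
  have : Module.Free (ZMod p) Q := Module.Free.of_divisionRing (ZMod p) Q
  have hfr : Module.finrank (ZMod p) Q = k := by
    have := Module.natCard_eq_pow_finrank (K := ZMod p) (V := Q)
    rw [hcardQ, Nat.card_zmod] at this
    exact (Nat.pow_right_injective hp.two_le this).symm
  let B : Module.Basis (Fin k) (ZMod p) Q := Module.finBasisOfFinrankEq (ZMod p) Q hfr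
  refine ⟨fun i => B i, fun i => B.ne_zero i, ?_⟩
  convert B.equivFun.symm.bijective using 1
  funext a
  rw [B.equivFun_symm_apply]
  refine Finset.sum_congr rfl fun i _ => ?_
  rw [← Nat.cast_smul_eq_nsmul (ZMod p), ZMod.natCast_zmod_val]

theorem exists_zmod_basis {Q : Type*} [AddCommGroup Q] (p : ℕ) (hp : p.Prime) (k : ℕ)
    (hpQ : ∀ q : Q, p • q = 0) (hcardQ : Nat.card Q = p ^ k) :
    ∃ B : Fin k → Q, (∀ i, B i ≠ 0) ∧
      Function.Bijective (fun a : Fin k → ZMod p => ∑ i, (a i).val • B i) := by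
  have : Fact p.Prime := ⟨hp⟩
  let inst : Module (ZMod p) Q := AddCommGroup.zmodModule hpQ
  exact exists_zmod_basis_aux p k hcardQ

theorem abstract_decomp (p : ℕ) (hp : p.Prime) (Φ : G → V) (hG : ∀ g : G, p ^ 2 • g = 0)
    (hA : ∀ u v, ∃ w, p • w = 0 ∧ Φ (u + v) = Φ u + Φ v + Φ w)
    (hB : ∀ x t, p • t = 0 → Φ (x + t) = Φ x + Φ t)
    (hinj : Function.Injective Φ) (𝒞 : AddSubgroup G) (N kbar : ℕ) (hN : kbar ≤ N)
    (hcard : Nat.card 𝒞 = p ^ N)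
    (hker : Nat.card (kernelSet (Φ '' (𝒞 : Set G))) = p ^ (N - kbar)) :
    ∃ v : Fin kbar → G,
      (∀ i, v i ∈ 𝒞 ∧ addOrderOf (v i) = p ^ 2 ∧ Φ (v i) ∉ kernelSet (Φ '' (𝒞 : Set G))) ∧
      (Φ '' (𝒞 : Set G) =
        ⋃ a : Fin kbar → ZMod p,
          cosetOf (kernelSet (Φ '' (𝒞 : Set G))) (Φ (∑ i, (a i).val • v i))) ∧
      (∀ a b : Fin kbar → ZMod p, a ≠ b →
        Disjoint
          (cosetOf (kernelSet (Φ '' (𝒞 : Set G))) (Φ (∑ i, (a i).val • v i)))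
          (cosetOf (kernelSet (Φ '' (𝒞 : Set G))) (Φ (∑ i, (b i).val • v i)))) := by
  have : Fact p.Prime := ⟨hp⟩
  set C : Set V := Φ '' (𝒞 : Set G) with hC
  have mC : ∀ x, Φ x ∈ C ↔ x ∈ 𝒞 := fun x => hinj.mem_set_image
  have h0 : Φ 0 = 0 := by simpa using hB 0 0 (by simp)
  have hKC : kernelSet C ⊆ C := by
    intro x hx
    have := (mem_kernelSet.1 hx).1 0 (h0 ▸ (mC 0).2 𝒞.zero_mem)
    simpa using this
  have hneg : ∀ t, p • t = 0 → -Φ t = Φ (-t) := by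
    intro t ht
    have := hB (-t) t ht
    rw [neg_add_cancel, h0] at this
    exact (eq_neg_of_add_eq_zero_left this.symm).symm
  have htors : ∀ t ∈ 𝒞, p • t = 0 → Φ t ∈ kernelSet C := by
    intro t ht hpt
    rw [mem_kernelSet]
    constructor
    · rintro _ ⟨c, hc, rfl⟩
      rw [add_comm, ← hB _ _ hpt, mC]
      exact 𝒞.add_mem hc ht
    · rintro _ ⟨c, hc, rfl⟩
      rw [hneg t hpt, add_comm, ← hB _ _ (by simpa using hpt), mC]
      exact 𝒞.add_mem hc (𝒞.neg_mem ht)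
  -- the key carry fact
  have hcarry : ∀ u v, Φ u ∈ kernelSet C → v ∈ 𝒞 →
      ∃ w ∈ 𝒞, p • w = 0 ∧ Φ w ∈ kernelSet C ∧ Φ (u + v) = Φ u + Φ v + Φ w := by
    intro u v hu hv
    obtain ⟨w, hw, h⟩ := hA u v
    have hu' : u ∈ 𝒞 := (mC u).1 (hKC hu)
    have h1 : Φ (u + v - w) = Φ u + Φ v := by
      have := hB (u + v - w) w hw
      rw [sub_add_cancel, h] at this
      exact (add_right_cancel this).symm
    have h2 : u + v - w ∈ 𝒞 := by
      rw [← mC, h1]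
      exact (mem_kernelSet.1 hu).1 _ ((mC v).2 hv)
    have h3 : w ∈ 𝒞 := by
      have := 𝒞.sub_mem (𝒞.add_mem hu' hv) h2
      simpa using this
    exact ⟨w, h3, hw, htors w h3 hw, h⟩
  obtain ⟨𝒦, mK⟩ : ∃ 𝒦 : AddSubgroup 𝒞, ∀ x : 𝒞, x ∈ 𝒦 ↔ Φ x ∈ kernelSet C := ⟨
    { carrier := {x | Φ x ∈ kernelSet C}
      zero_mem' := htors _ 𝒞.zero_mem (by simp)
      add_mem' := by
        intro a b ha hb
        obtain ⟨w, -, -, hw, h⟩ := hcarry a b ha b.2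
        change Φ (a + b : G) ∈ kernelSet C
        rw [h]
        exact kernelSet_add (kernelSet_add ha hb) hw
      neg_mem' := by
        intro a ha
        obtain ⟨w, -, -, hw, h⟩ := hcarry a (-a) ha (𝒞.neg_mem a.2)
        rw [add_neg_cancel, h0] at h
        change Φ (-a : G) ∈ kernelSet C
        have : Φ (-a : G) = -(Φ a + Φ w) := by
          rw [eq_neg_iff_add_eq_zero, h]; abel
        rw [this]
        exact kernelSet_neg (kernelSet_add ha hw) }, fun x => Iff.rfl⟩
  have hcoset : ∀ x w : 𝒞, Φ x ∈ cosetOf (kernelSet C) (Φ w) ↔ x - w ∈ 𝒦 := by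
    intro x w
    constructor
    · rintro ⟨y, hy, hxy⟩
      obtain ⟨k, hk, rfl⟩ := hKC hy
      obtain ⟨t, ht, hpt, hkt, h⟩ := hcarry k w hy w.2
      have h' : Φ (k + w) = Φ (x + t) := by rw [hB _ _ hpt, h]; rw [← hxy]
      have h2 := hinj h'
      have h3 : x - w = (⟨k, hk⟩ : 𝒞) - ⟨t, ht⟩ := by
        ext
        simp only [AddSubgroup.coe_sub]
        rw [sub_eq_sub_iff_add_eq_add, ← h2]
      rw [h3]
      exact 𝒦.sub_mem ((mK _).2 hy) ((mK _).2 hkt)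
    · intro h
      obtain ⟨t, ht, hpt, hkt, h'⟩ := hcarry _ w ((mK _).1 h) w.2
      refine ⟨_, kernelSet_add ((mK _).1 h) hkt, ?_⟩
      simp only [AddSubgroup.coe_sub, sub_add_cancel] at h' ⊢
      rw [h']; abel
  have hcardK : Nat.card 𝒦 = p ^ (N - kbar) := by
    rw [← hker]
    refine Nat.card_congr (Equiv.ofBijective (fun x => ⟨Φ x.1.1, (mK _).1 x.2⟩) ⟨?_, ?_⟩)
    · intro a b h
      exact Subtype.ext (Subtype.ext (hinj (congrArg Subtype.val h)))
    · rintro ⟨y, hy⟩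
      obtain ⟨k, hk, rfl⟩ := hKC hy
      exact ⟨⟨⟨k, hk⟩, (mK _).2 hy⟩, rfl⟩
  have hcardQ : Nat.card (𝒞 ⧸ 𝒦) = p ^ kbar := by
    have := AddSubgroup.card_eq_card_quotient_mul_card_addSubgroup 𝒦
    rw [hcard, hcardK] at this
    have h2 : p ^ N = p ^ kbar * p ^ (N - kbar) := by rw [← pow_add]; congr 1; omega
    rw [h2] at this
    exact (Nat.eq_of_mul_eq_mul_right (pow_pos hp.pos _) this).symm
  have hpQ : ∀ q : 𝒞 ⧸ 𝒦, p • q = 0 := by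
    intro q
    obtain ⟨x, rfl⟩ := QuotientAddGroup.mk_surjective q
    rw [← QuotientAddGroup.mk_nsmul, QuotientAddGroup.eq_zero_iff, mK]
    apply htors _ (p • x).2
    rw [AddSubgroup.coe_nsmul, ← mul_nsmul, ← pow_two]
    exact hG _
  obtain ⟨B, hB0, hBb⟩ := exists_zmod_basis p hp kbar hpQ hcardQ
  choose v hv using fun i => QuotientAddGroup.mk_surjective (s := 𝒦) (B i)
  have hsum : ∀ a : Fin kbar → ZMod p,
      ((∑ i, (a i).val • v i : 𝒞) : 𝒞 ⧸ 𝒦) = ∑ i, (a i).val • B i := by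
    intro a
    have : ((∑ i, (a i).val • v i : 𝒞) : 𝒞 ⧸ 𝒦) =
      QuotientAddGroup.mk' 𝒦 (∑ i, (a i).val • v i) := rfl
    rw [this, map_sum]
    refine Finset.sum_congr rfl fun i _ => ?_
    rw [map_nsmul, QuotientAddGroup.mk'_apply, hv]
  have hcoe : ∀ a : Fin kbar → ZMod p,
      (∑ i, (a i).val • (v i : G)) = ((∑ i, (a i).val • v i : 𝒞) : G) := by
    intro a; simp
  have hmem : ∀ (a : Fin kbar → ZMod p) (x : 𝒞),
      Φ x ∈ cosetOf (kernelSet C) (Φ (∑ i, (a i).val • (v i : G))) ↔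
        (x : 𝒞 ⧸ 𝒦) = ∑ i, (a i).val • B i := by
    intro a x
    rw [hcoe, hcoset, ← hsum, ← sub_eq_zero, ← QuotientAddGroup.mk_sub,
      QuotientAddGroup.eq_zero_iff]
  have hsub : ∀ a : Fin kbar → ZMod p, ∀ y ∈
      cosetOf (kernelSet C) (Φ (∑ i, (a i).val • (v i : G))), ∃ x : 𝒞, Φ x = y := by
    rintro a _ ⟨k, hk, rfl⟩
    rw [hcoe]
    obtain ⟨x, hx, h⟩ := (mem_kernelSet.1 hk).1 _ ((mC _).2 (∑ i, (a i).val • v i : 𝒞).2)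
    exact ⟨⟨x, hx⟩, h⟩
  have hnot : ∀ i, Φ (v i) ∉ kernelSet C := by
    intro i h
    have h1 : v i ∈ 𝒦 := (mK _).2 h
    rw [← QuotientAddGroup.eq_zero_iff, hv] at h1
    exact hB0 i h1
  refine ⟨fun i => (v i : G), fun i => ⟨(v i).2, ?_, hnot i⟩, ?_, ?_⟩
  · apply addOrderOf_eq_prime_pow (n := 1)
    · rw [pow_one]
      exact fun h => hnot i (htors _ (v i).2 h)
    · exact hG _
  · ext y
    rw [Set.mem_iUnion]
    constructor
    · rintro ⟨x, hx, rfl⟩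
      obtain ⟨a, ha⟩ := hBb.2 ((⟨x, hx⟩ : 𝒞) : 𝒞 ⧸ 𝒦)
      exact ⟨a, (hmem _ ⟨x, hx⟩).2 ha.symm⟩
    · rintro ⟨a, ha⟩
      obtain ⟨x, rfl⟩ := hsub a y ha
      exact ⟨x, x.2, rfl⟩
  · intro a b hab
    rw [Set.disjoint_left]
    intro y ha hb
    obtain ⟨x, rfl⟩ := hsub a y ha
    rw [hmem] at ha hb
    apply hab
    exact hBb.1 (ha.symm.trans hb)

end abs

/-- If `ker(C) = γ + 2δ − kbar` with `1 ≤ kbar ≤ δ`, then there are `kbar` codewords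
`v₁, …, v_kbar ∈ 𝒞` of order `p²` with `Φ(vᵢ) ∉ K(C)` such that `C` is the disjoint
union of the `p^kbar` cosets `K(C) + Φ(∑ aᵢ vᵢ)`, `a ∈ (ZMod p)^kbar`. -/
theorem coset_decomposition (p : ℕ) (hp : p.Prime) (hodd : Odd p) (α β γ δ kbar : ℕ)
    (𝒞 : AddSubgroup ((Fin α → ZMod p) × (Fin β → ZMod (p ^ 2))))
    (e : 𝒞 ≃+ (Fin γ → ZMod p) × (Fin δ → ZMod (p ^ 2)))
    (hk1 : 1 ≤ kbar) (hk2 : kbar ≤ δ)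
    (hker : Nat.card
        (kernelSet (Gray p α β '' (𝒞 : Set ((Fin α → ZMod p) × (Fin β → ZMod (p ^ 2)))))) =
      p ^ (γ + 2 * δ - kbar)) :
    ∃ v : Fin kbar → (Fin α → ZMod p) × (Fin β → ZMod (p ^ 2)),
      (∀ i, v i ∈ 𝒞 ∧ addOrderOf (v i) = p ^ 2 ∧
        Gray p α β (v i) ∉
          kernelSet (Gray p α β '' (𝒞 : Set ((Fin α → ZMod p) × (Fin β → ZMod (p ^ 2)))))) ∧
      (Gray p α β '' (𝒞 : Set ((Fin α → ZMod p) × (Fin β → ZMod (p ^ 2)))) =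
        ⋃ a : Fin kbar → ZMod p,
          cosetOf
            (kernelSet (Gray p α β '' (𝒞 : Set ((Fin α → ZMod p) × (Fin β → ZMod (p ^ 2))))))
            (Gray p α β (∑ i, (a i).val • v i))) ∧
      (∀ a b : Fin kbar → ZMod p, a ≠ b →
        Disjoint
          (cosetOf
            (kernelSet (Gray p α β '' (𝒞 : Set ((Fin α → ZMod p) × (Fin β → ZMod (p ^ 2))))))
            (Gray p α β (∑ i, (a i).val • v i)))
          (cosetOf
            (kernelSet (Gray p α β '' (𝒞 : Set ((Fin α → ZMod p) × (Fin β → ZMod (p ^ 2))))))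
            (Gray p α β (∑ i, (b i).val • v i)))) := by
  have hp0 := hp.ne_zero
  refine abstract_decomp p hp (Gray p α β) ?_ ?_ ?_ ?_ 𝒞 (γ + 2 * δ) kbar (by omega) ?_ hker
  · rintro ⟨x, y⟩
    refine Prod.ext ?_ ?_
    · funext i
      simp [nsmul_eq_mul]
    · funext i
      change p ^ 2 • y i = 0
      rw [nsmul_eq_mul, ZMod.natCast_self, zero_mul]
  · intro u v
    choose t ht h using fun j => gray_add p hp (u.2 j) (v.2 j)
    refine ⟨(0, t), ?_, ?_⟩
    · refine Prod.ext (by simp) (funext ht)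
    · refine Prod.ext (by simp [Gray]) (funext h)
  · intro x t ht
    have h2 := congrArg Prod.snd ht
    refine Prod.ext rfl (funext fun j => gray_add_tors p hp _ _ (congrFun h2 j))
  · intro x y h
    refine Prod.ext (congrArg (fun z => z.1) h :) (funext fun j => gray_injective p hp ?_)
    exact congrFun (congrArg (fun z => z.2) h :) j
  · rw [Nat.card_congr e.toEquiv, Nat.card_prod, Nat.card_fun, Nat.card_fun]
    simp [Nat.card_zmod, pow_add, pow_mul]
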